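/- Let f ∈ H^{1/2}(ℝ^d) (i.e. ∬ |f(x)−f(y)|²/|x−y|^{d+1} dx dy < ∞), and let K_L(x,y) = 2^{d/2} Γ(d/2+1) L^{d/2} J_{d/2}(Lπ|x−y|) / (π|x−y|)^{d/2} be the rescaled Bessel kernel. Then lim_{L→∞} L^{−(d−1)} · (1/2) ∬ |f(x)−f(y)|² K_L(x,y)² dx dy = (2^{d−1} Γ(d/2+1)² / π^{d+2}) ∬ |f(x)−f(y)|²/|x−y|^{d+1} dx dy. -/

import Mathlib

open MeasureTheory Real Filter

noncomputable section

/-- The Bessel function of the first kind `J_α` (Poisson integral representation,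
valid for `α > −1/2`). -/
def besselJ (α : ℝ) (z : ℝ) : ℝ :=
  (z / 2) ^ α / (Real.sqrt π * Real.Gamma (α + 1 / 2)) *
    ∫ t in (-1 : ℝ)..1, Real.cos (z * t) * (1 - t ^ 2) ^ (α - 1 / 2)

/-- The rescaled Bessel kernel on `ℝ^d` with intensity `L^d`. -/
def besselKernel (d : ℕ) (L : ℝ) (x y : EuclideanSpace ℝ (Fin d)) : ℝ :=
  2 ^ ((d : ℝ) / 2) * Real.Gamma ((d : ℝ) / 2 + 1) *
    (L ^ ((d : ℝ) / 2) * besselJ ((d : ℝ) / 2) (L * π * ‖x - y‖) / (π * ‖x - y‖) ^ ((d : ℝ) / 2))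


lemma bs_cpow_cont {ν : ℝ} (hν : 0 ≤ ν) {w : ℂ} (hw : 0 ≤ w.re) :
    ContinuousAt (fun x : ℂ => x ^ (ν : ℂ)) w := by
  rcases hν.eq_or_lt with h | h
  · subst h; simpa using continuousAt_const
  · exact Complex.continuousAt_cpow_const_of_re_pos (Or.inl hw) (by simpa using h)

def bsF (ν z : ℝ) (w : ℂ) : ℂ := Complex.exp (Complex.I * z * w) * (1 - w ^ 2) ^ (ν : ℂ)

lemma bs_re (w : ℂ) : (1 - w ^ 2).re = 1 - w.re ^ 2 + w.im ^ 2 := by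
  simp [pow_two]; ring

lemma bs_contour {ν : ℝ} (hν : 0 ≤ ν) (z : ℝ) {R : ℝ} (hR : 0 ≤ R) :
    ∫ x in (0:ℝ)..1, Real.cos (z * x) * (1 - x ^ 2) ^ ν =
      (∫ x in (0:ℝ)..1, bsF ν z (x + R * Complex.I)).re
      - (Complex.I * ∫ y in (0:ℝ)..R, bsF ν z (1 + y * Complex.I)).re := by
  have key := Complex.integral_boundary_rect_eq_zero_of_continuousOn_of_differentiableOn
    (bsF ν z) 0 (1 + R * Complex.I) ?_ ?_
  · simp only [Complex.zero_re, Complex.zero_im, Complex.add_re, Complex.one_re, Complex.mul_re,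
      Complex.ofReal_re, Complex.I_re, Complex.ofReal_im, Complex.I_im, Complex.add_im,
      Complex.one_im, Complex.mul_im, mul_zero, mul_one, zero_mul, sub_zero, add_zero, zero_add,
      Complex.ofReal_zero, Complex.ofReal_one, smul_eq_mul] at key
    have h1 : ∫ x in (0:ℝ)..1, Real.cos (z * x) * (1 - x ^ 2) ^ ν
        = (∫ x in (0:ℝ)..1, bsF ν z x).re := by
      have hc : Continuous fun x : ℝ => Complex.exp (Complex.I * z * x) *
          (((1 - x ^ 2) ^ ν : ℝ) : ℂ) := by
        have : Continuous fun x : ℝ => (1 - x ^ 2) ^ ν :=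
          (by fun_prop : Continuous fun x : ℝ => 1 - x ^ 2).rpow_const (fun _ => Or.inr hν)
        fun_prop
      have e : ∫ x in (0:ℝ)..1, bsF ν z x = ∫ x in (0:ℝ)..1, Complex.exp (Complex.I * z * x) *
          (((1 - x ^ 2) ^ ν : ℝ) : ℂ) := by
        apply intervalIntegral.integral_congr
        intro x hx
        rw [Set.uIcc_of_le zero_le_one] at hx
        have : 0 ≤ 1 - x ^ 2 := by nlinarith [hx.1, hx.2]
        simp only [bsF]
        rw [Complex.ofReal_cpow this]; push_cast; rfl
      rw [e]
      have := Complex.reCLM.intervalIntegral_comp_comm (hc.intervalIntegrable (μ := volume) 0 1)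
      simp only [Complex.reCLM_apply] at this
      rw [← this]
      apply intervalIntegral.integral_congr
      intro x _
      simp only
      rw [Complex.re_mul_ofReal, Complex.exp_re]
      simp
    have h2 : (Complex.I * ∫ y in (0:ℝ)..R, bsF ν z (y * Complex.I)).re = 0 := by
      have : ∫ y in (0:ℝ)..R, bsF ν z (y * Complex.I) =
          ((∫ y in (0:ℝ)..R, Real.exp (-(z * y)) * (1 + y ^ 2) ^ ν : ℝ) : ℂ) := by
        rw [← intervalIntegral.integral_ofReal]
        apply intervalIntegral.integral_congr
        intro y _
        simp only [bsF]
        push_cast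
        rw [Complex.ofReal_cpow (by positivity)]
        push_cast
        congr 2
        · linear_combination (z * y : ℂ) * Complex.I_sq
        · linear_combination (-(y:ℂ)^2) * Complex.I_sq
      rw [this]; simp
    rw [h1]
    have := congrArg Complex.re key
    simp only [Complex.add_re, Complex.sub_re, Complex.zero_re] at this
    linarith
  · intro w hw
    have hw' := Complex.mem_reProdIm.1 hw
    simp [Set.uIcc_of_le, hR] at hw'
    apply ContinuousAt.continuousWithinAt
    have : 0 ≤ (1 - w ^ 2).re := by rw [bs_re]; nlinarith
    have h2 := (bs_cpow_cont hν this).comp (f := fun w : ℂ => 1 - w ^ 2) (x := w) (by fun_prop)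
    unfold bsF
    exact ContinuousAt.mul (by fun_prop) h2
  · intro w hw
    have hw' := Complex.mem_reProdIm.1 hw
    simp [hR] at hw'
    have : 0 < (1 - w ^ 2).re := by rw [bs_re]; nlinarith
    unfold bsF
    apply DifferentiableAt.differentiableWithinAt
    refine DifferentiableAt.mul (by fun_prop) ?_
    exact DifferentiableAt.cpow_const (by fun_prop) (Or.inl this)

/-- the dominating function -/
lemma bs_dom_integrable {ν : ℝ} (hν : 0 ≤ ν) :
    IntegrableOn (fun u : ℝ => Real.exp (-u) * (u ^ 2 + 2 * u) ^ ν) (Set.Ioi 0) := by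
  refine integrable_of_isBigO_exp_neg (b := 1/2) (by norm_num) ?_ ?_
  · apply Continuous.continuousOn
    exact (by fun_prop : Continuous fun u : ℝ => Real.exp (-u)).mul
      ((by fun_prop : Continuous fun u : ℝ => u ^ 2 + 2 * u).rpow_const (fun _ => Or.inr hν))
  · have h := (isLittleO_rpow_exp_pos_mul_atTop (2 * ν) (b := 1/2) (by norm_num)).isBigO
    have h2 : (fun u : ℝ => (u ^ 2 + 2 * u) ^ ν) =O[atTop] fun u : ℝ => u ^ (2 * ν) := by
      refine Asymptotics.IsBigO.of_bound (3 ^ ν) ?_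
      filter_upwards [eventually_ge_atTop 1] with u hu
      have hu0 : 0 ≤ u := by linarith
      rw [Real.norm_of_nonneg (by positivity), Real.norm_of_nonneg (by positivity),
        Real.rpow_mul hu0, ← Real.mul_rpow (by norm_num) (by positivity)]
      apply Real.rpow_le_rpow (by positivity) _ hν
      norm_num
      nlinarith
    have h3 := (Asymptotics.isBigO_refl (fun u : ℝ => Real.exp (-u)) atTop).mul (h2.trans h)
    refine h3.congr_right ?_
    intro u
    rw [← Real.exp_add]; congr 1; ring

lemma bs_F_one (ν z y : ℝ) : bsF ν z (1 + y * Complex.I) =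
    Complex.exp (Complex.I * z) * (Complex.exp (-(z * y : ℝ)) *
      ((y:ℂ) ^ 2 - 2 * Complex.I * y) ^ (ν : ℂ)) := by
  unfold bsF
  rw [← mul_assoc, ← Complex.exp_add]
  congr 2
  · push_cast; linear_combination (z * y : ℂ) * Complex.I_sq
  · linear_combination (-(y:ℂ)^2) * Complex.I_sq

lemma bs_norm_base {a y : ℝ} (ha : 0 ≤ a) (ha1 : a ≤ 1) (hy : 0 ≤ y) (ν : ℝ) (hν : 0 ≤ ν) :
    ‖((a * y ^ 2 : ℝ) - 2 * Complex.I * y : ℂ) ^ (ν : ℂ)‖ ≤ (y ^ 2 + 2 * y) ^ ν := by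
  rw [Complex.norm_cpow_real]
  apply Real.rpow_le_rpow (norm_nonneg _) _ hν
  refine (norm_sub_le _ _).trans ?_
  simp only [Complex.norm_real, norm_mul, Complex.norm_I, Complex.norm_two, Real.norm_eq_abs]
  rw [abs_of_nonneg (by positivity), abs_of_nonneg hy]
  rw [abs_of_nonneg (sq_nonneg y)]
  nlinarith [sq_nonneg y]

lemma bs_meas_base {ν : ℝ} (a : ℝ) :
    Measurable fun y : ℝ => ((a * y ^ 2 : ℝ) - 2 * Complex.I * y : ℂ) ^ (ν : ℂ) := by
  fun_prop

lemma bs_F_integrable {ν : ℝ} (hν : 0 ≤ ν) {z : ℝ} (hz : 1 ≤ z) :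
    IntegrableOn (fun y : ℝ => Complex.exp (-(z * y : ℝ)) *
      ((y:ℂ) ^ 2 - 2 * Complex.I * y) ^ (ν : ℂ)) (Set.Ioi 0) := by
  refine (bs_dom_integrable hν).mono' (by fun_prop) ?_
  refine (ae_restrict_mem measurableSet_Ioi).mono ?_
  intro y (hy : 0 < y)
  rw [norm_mul]
  have := bs_norm_base (a := 1) (by norm_num) le_rfl hy.le ν hν
  simp only [one_mul, Complex.ofReal_pow] at this
  refine mul_le_mul ?_ this (norm_nonneg _) (by positivity)
  rw [← Complex.ofReal_neg, ← Complex.ofReal_exp, Complex.norm_real, Real.norm_eq_abs, Real.abs_exp]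
  apply Real.exp_le_exp.2; nlinarith

lemma bs_top {ν : ℝ} (hν : 0 ≤ ν) {z : ℝ} (hz : 1 ≤ z) :
    Tendsto (fun R : ℝ => ∫ x in (0:ℝ)..1, bsF ν z (x + R * Complex.I)) atTop (nhds 0) := by
  have hlim : Tendsto (fun R : ℝ => (9:ℝ) ^ ν * (R ^ (2 * ν) * Real.exp (-1 * R))) atTop (nhds 0) := by
    have := (tendsto_rpow_mul_exp_neg_mul_atTop_nhds_zero (2 * ν) 1 one_pos).const_mul ((9:ℝ) ^ ν)
    simpa using this
  refine squeeze_zero_norm' ?_ hlim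
  filter_upwards [eventually_ge_atTop 1] with R hR
  have hR0 : 0 ≤ R := by linarith
  refine (intervalIntegral.norm_integral_le_of_norm_le_const
    (C := (9:ℝ) ^ ν * (R ^ (2 * ν) * Real.exp (-1 * R))) ?_).trans (by simp)
  intro x hx
  rw [Set.uIoc_of_le zero_le_one] at hx
  unfold bsF
  rw [norm_mul, Complex.norm_cpow_real, Complex.norm_exp, mul_comm, ← mul_assoc]
  refine mul_le_mul ?_ ?_ (by positivity) (by positivity)
  · rw [Real.rpow_mul hR0, ← Real.mul_rpow (by norm_num) (by positivity)]
    apply Real.rpow_le_rpow (norm_nonneg _) _ hν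
    refine (norm_sub_le _ _).trans ?_
    rw [norm_pow]
    have h1 : ‖(x + R * Complex.I : ℂ)‖ ≤ 1 + R := by
      refine (norm_add_le _ _).trans ?_
      simp only [Complex.norm_real, norm_mul, Complex.norm_I, Real.norm_eq_abs]
      rw [abs_of_nonneg hx.1.le, abs_of_nonneg hR0]; linarith [hx.2]
    have h2 := pow_le_pow_left₀ (norm_nonneg _) h1 2
    norm_num
    nlinarith
  · apply Real.exp_le_exp.2
    simp
    nlinarith

lemma bs_half {ν : ℝ} (hν : 0 ≤ ν) {z : ℝ} (hz : 1 ≤ z) :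
    ∫ x in (0:ℝ)..1, Real.cos (z * x) * (1 - x ^ 2) ^ ν =
      - (Complex.I * (Complex.exp (Complex.I * z) * ∫ y in Set.Ioi (0:ℝ), Complex.exp (-(z * y : ℝ)) *
      ((y:ℂ) ^ 2 - 2 * Complex.I * y) ^ (ν : ℂ))).re := by
  have h1 := bs_top hν hz
  have h2 := intervalIntegral_tendsto_integral_Ioi 0 (bs_F_integrable hν hz) tendsto_id
  have h3 := ((h2.const_mul (Complex.exp (Complex.I * z))).const_mul Complex.I)
  have h4 := (Complex.continuous_re.tendsto _).comp h1
  have h5 := h4.sub ((Complex.continuous_re.tendsto _).comp h3)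
  rw [Complex.zero_re, zero_sub] at h5
  refine tendsto_nhds_unique ?_ h5
  refine tendsto_const_nhds.congr' ?_
  filter_upwards [eventually_ge_atTop 0] with R hR
  rw [bs_contour hν z hR]
  simp only [Function.comp, bs_F_one, intervalIntegral.integral_const_mul, id]

lemma bs_real_cpow {a : ℝ} (ha : 0 < a) (w : ℂ) (ν : ℝ) (hw : w ≠ 0) :
    ((a : ℂ) * w) ^ (ν : ℂ) = ((a ^ ν : ℝ) : ℂ) * w ^ (ν : ℂ) := by
  have ha' : (a : ℂ) ≠ 0 := by exact_mod_cast ha.ne'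
  rw [Complex.cpow_def_of_ne_zero (mul_ne_zero ha' hw), Complex.log_ofReal_mul ha hw, add_mul,
    Complex.exp_add, ← Complex.cpow_def_of_ne_zero hw, Complex.ofReal_log ha.le,
    ← Complex.cpow_def_of_ne_zero ha', Complex.ofReal_cpow ha.le]

def bsG (ν z : ℝ) : ℂ := ∫ u in Set.Ioi (0:ℝ), Complex.exp (-(u : ℝ)) *
      (((1 / z) * u ^ 2 : ℝ) - 2 * Complex.I * u) ^ (ν : ℂ)

lemma bs_ne {a y : ℝ} (hy : 0 < y) : ((a : ℝ) - 2 * Complex.I * y : ℂ) ≠ 0 := by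
  intro h
  have := congrArg Complex.im h
  simp at this
  exact hy.ne' this

lemma bs_scale (ν : ℝ) {z : ℝ} (hz : 0 < z) :
    ((z ^ (ν + 1) : ℝ) : ℂ) * (∫ y in Set.Ioi (0:ℝ), Complex.exp (-(z * y : ℝ)) *
      ((y:ℂ) ^ 2 - 2 * Complex.I * y) ^ (ν : ℂ)) = bsG ν z := by
  have := integral_comp_mul_left_Ioi (fun u : ℝ => Complex.exp (-(u : ℝ)) *
      (((1 / z) * u ^ 2 : ℝ) - 2 * Complex.I * u) ^ (ν : ℂ)) 0 hz
  rw [mul_zero] at this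
  unfold bsG
  have h2 : ∫ x in Set.Ioi (0:ℝ), Complex.exp (-((z * x : ℝ) : ℂ)) *
      (((1 / z) * (z * x) ^ 2 : ℝ) - 2 * Complex.I * (z * x : ℝ)) ^ (ν : ℂ) =
      ((z ^ ν : ℝ) : ℂ) * (∫ y in Set.Ioi (0:ℝ), Complex.exp (-(z * y : ℝ)) *
      ((y:ℂ) ^ 2 - 2 * Complex.I * y) ^ (ν : ℂ)) := by
    rw [← integral_const_mul]
    apply setIntegral_congr_fun measurableSet_Ioi
    intro y (hy : 0 < y)
    simp only
    have e : ((((1 / z) * (z * y) ^ 2 : ℝ) : ℂ) - 2 * Complex.I * (z * y : ℝ)) =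
        z * ((y:ℂ) ^ 2 - 2 * Complex.I * y) := by
      have hz' : (z : ℂ) ≠ 0 := by exact_mod_cast hz.ne'
      push_cast; field_simp
    rw [e, bs_real_cpow hz _ _ (by have := bs_ne (a := y ^ 2) hy; push_cast at this; exact this)]
    ring
  rw [h2] at this
  rw [Real.rpow_add hz, Real.rpow_one]
  push_cast
  push_cast at this
  rw [mul_right_comm, this, Complex.real_smul]
  have hz' : (z : ℂ) ≠ 0 := by exact_mod_cast hz.ne'
  push_cast
  field_simp

def bsC (ν : ℝ) : ℂ := ∫ u in Set.Ioi (0:ℝ), Complex.exp (-(u : ℝ)) *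
      ((0 * u ^ 2 : ℝ) - 2 * Complex.I * u) ^ (ν : ℂ)

lemma bs_dom_bound {ν : ℝ} (hν : 0 ≤ ν) {a : ℝ} (ha : 0 ≤ a) (ha1 : a ≤ 1) :
    ∀ᵐ u ∂(volume.restrict (Set.Ioi (0:ℝ))), ‖Complex.exp (-(u : ℝ)) *
      ((a * u ^ 2 : ℝ) - 2 * Complex.I * u) ^ (ν : ℂ)‖ ≤ Real.exp (-u) * (u ^ 2 + 2 * u) ^ ν := by
  refine (ae_restrict_mem measurableSet_Ioi).mono ?_
  intro y (hy : 0 < y)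
  rw [norm_mul]
  refine mul_le_mul ?_ (bs_norm_base ha ha1 hy.le ν hν) (norm_nonneg _) (by positivity)
  rw [← Complex.ofReal_neg, ← Complex.ofReal_exp, Complex.norm_real, Real.norm_eq_abs, Real.abs_exp]

lemma bs_G_bound {ν : ℝ} (hν : 0 ≤ ν) {z : ℝ} (hz : 1 ≤ z) :
    ‖bsG ν z‖ ≤ ∫ u in Set.Ioi (0:ℝ), Real.exp (-u) * (u ^ 2 + 2 * u) ^ ν :=
  norm_integral_le_of_norm_le (bs_dom_integrable hν) (bs_dom_bound hν (by positivity)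
    (by rw [div_le_one (by linarith)]; exact hz))

lemma bs_G_tendsto {ν : ℝ} (hν : 0 ≤ ν) : Tendsto (bsG ν) atTop (nhds (bsC ν)) := by
  refine tendsto_integral_filter_of_dominated_convergence _ ?_ ?_ (bs_dom_integrable hν) ?_
  · exact Eventually.of_forall fun z => by fun_prop
  · filter_upwards [eventually_ge_atTop 1] with z hz
    exact bs_dom_bound hν (by positivity) (by rw [div_le_one (by linarith)]; exact hz)
  · refine (ae_restrict_mem measurableSet_Ioi).mono ?_
    intro y (hy : 0 < y)
    apply Tendsto.const_mul
    have hc : ContinuousAt (fun x : ℂ => x ^ (ν : ℂ)) ((0 * y ^ 2 : ℝ) - 2 * Complex.I * y) := by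
      apply bs_cpow_cont hν; simp
    refine hc.tendsto.comp ?_
    apply Tendsto.sub_const
    refine (Complex.continuous_ofReal.tendsto _).comp ?_
    apply Tendsto.mul_const
    exact (tendsto_inv_atTop_zero (𝕜 := ℝ)).congr (fun x => (one_div x).symm)

lemma bs_C_norm {ν : ℝ} (hν : 0 ≤ ν) : ‖bsC ν‖ = 2 ^ ν * Real.Gamma (ν + 1) := by
  have : bsC ν = (Real.Gamma (ν + 1) : ℂ) * (-2 * Complex.I) ^ (ν : ℂ) := by
    rw [Real.Gamma_eq_integral (by linarith), ← integral_complex_ofReal, ← integral_mul_const]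
    apply setIntegral_congr_fun measurableSet_Ioi
    intro y (hy : 0 < y)
    simp only
    rw [show ((0 * y ^ 2 : ℝ) - 2 * Complex.I * y : ℂ) = y * (-2 * Complex.I) by push_cast; ring,
      bs_real_cpow hy _ _ (by simp)]
    push_cast
    rw [add_sub_cancel_right]; ring
  rw [this, norm_mul, Complex.norm_cpow_real, Complex.norm_real, Real.norm_of_nonneg
    (Real.Gamma_pos_of_pos (by linarith)).le]
  simp [mul_comm]

def bsI (ν z : ℝ) : ℝ := ∫ t in (-1 : ℝ)..1, Real.cos (z * t) * (1 - t ^ 2) ^ ν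

lemma bs_I_cont {ν : ℝ} (hν : 0 ≤ ν) : Continuous (bsI ν) := by
  unfold bsI
  apply intervalIntegral.continuous_parametric_intervalIntegral_of_continuous'
  have : Continuous fun p : ℝ × ℝ => (1 - p.2 ^ 2) ^ ν :=
    (by fun_prop : Continuous fun p : ℝ × ℝ => 1 - p.2 ^ 2).rpow_const (fun _ => Or.inr hν)
  unfold Function.uncurry
  fun_prop

lemma bs_I_half {ν : ℝ} (hν : 0 ≤ ν) (z : ℝ) :
    bsI ν z = 2 * ∫ x in (0:ℝ)..1, Real.cos (z * x) * (1 - x ^ 2) ^ ν := by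
  have hc : Continuous fun x : ℝ => Real.cos (z * x) * (1 - x ^ 2) ^ ν := by
    have : Continuous fun x : ℝ => (1 - x ^ 2) ^ ν :=
      (by fun_prop : Continuous fun x : ℝ => 1 - x ^ 2).rpow_const (fun _ => Or.inr hν)
    fun_prop
  unfold bsI
  rw [← intervalIntegral.integral_add_adjacent_intervals (b := 0) (hc.intervalIntegrable _ _)
    (hc.intervalIntegrable _ _)]
  have := intervalIntegral.integral_comp_neg (a := 0) (b := 1)
    (fun x : ℝ => Real.cos (z * x) * (1 - x ^ 2) ^ ν)
  simp only [mul_neg, Real.cos_neg, neg_sq, neg_zero] at this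
  rw [← this]; ring

def bsH (ν z : ℝ) : ℝ := (z ^ (ν + 1) * bsI ν z) ^ 2

lemma bs_H_eq {ν : ℝ} (hν : 0 ≤ ν) {z : ℝ} (hz : 1 ≤ z) :
    bsH ν z = 2 * ‖bsG ν z‖ ^ 2 - 2 * (Complex.exp (Complex.I * (2 * z)) * bsG ν z ^ 2).re := by
  unfold bsH
  rw [bs_I_half hν, bs_half hν hz, ← bs_scale ν (by linarith : 0 < z)]
  set Q := ∫ y in Set.Ioi (0:ℝ), Complex.exp (-(z * y : ℝ)) *
      ((y:ℂ) ^ 2 - 2 * Complex.I * y) ^ (ν : ℂ)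
  set a := z ^ (ν + 1)
  have he : Complex.exp (Complex.I * (2 * z)) = Complex.exp (Complex.I * z) ^ 2 := by
    rw [← Complex.exp_nat_mul]; congr 1; push_cast; ring
  have hn : ‖(a : ℂ) * Q‖ ^ 2 = ‖Complex.exp (Complex.I * z) * ((a : ℂ) * Q)‖ ^ 2 := by
    rw [norm_mul (Complex.exp _), mul_comm Complex.I, Complex.norm_exp_ofReal_mul_I, one_mul]
  rw [he, hn, ← mul_pow, show Complex.exp (Complex.I * z) * ((a : ℂ) * Q) =
    (a : ℂ) * (Complex.exp (Complex.I * z) * Q) by ring]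
  set P := Complex.exp (Complex.I * z) * Q
  rw [← Complex.normSq_eq_norm_sq, Complex.normSq_apply, pow_two ((a : ℂ) * P)]
  simp
  ring

lemma bs_H_bound {ν : ℝ} (hν : 0 ≤ ν) : ∃ M, ∀ z, 0 ≤ z → |bsH ν z| ≤ M := by
  set B := ∫ u in Set.Ioi (0:ℝ), Real.exp (-u) * (u ^ 2 + 2 * u) ^ ν
  have hc : Continuous (bsH ν) := by
    unfold bsH
    exact ((Real.continuous_rpow_const (by linarith)).mul (bs_I_cont hν)).pow 2
  obtain ⟨M, hM⟩ := (isCompact_Icc (a := (0:ℝ)) (b := 1)).exists_bound_of_continuousOn hc.continuousOn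
  refine ⟨max M (4 * B ^ 2), fun z hz => ?_⟩
  rcases le_total z 1 with h | h
  · exact (hM z ⟨hz, h⟩).trans (le_max_left _ _)
  · refine le_trans ?_ (le_max_right _ _)
    have hG := bs_G_bound hν h
    have h2 := pow_le_pow_left₀ (norm_nonneg _) hG 2
    rw [bs_H_eq hν h]
    have h3 : |(Complex.exp (Complex.I * (2 * z)) * bsG ν z ^ 2).re| ≤ ‖bsG ν z‖ ^ 2 := by
      refine (Complex.abs_re_le_norm _).trans ?_
      rw [norm_mul, norm_pow, show Complex.I * (2 * z) = ((2 * z : ℝ) : ℂ) * Complex.I by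
        push_cast; ring, Complex.norm_exp_ofReal_mul_I, one_mul]
    have := abs_le.1 h3
    rw [abs_le]; constructor <;> nlinarith [sq_nonneg ‖bsG ν z‖]

lemma bs_H_tendsto {ν : ℝ} (hν : 0 ≤ ν) :
    Tendsto (fun z => bsH ν z - (2 * ‖bsC ν‖ ^ 2 -
      2 * (Complex.exp (Complex.I * (2 * z)) * bsC ν ^ 2).re)) atTop (nhds 0) := by
  have hG := bs_G_tendsto hν
  have h1 : Tendsto (fun z => 2 * (‖bsG ν z‖ ^ 2 - ‖bsC ν‖ ^ 2)) atTop (nhds 0) := by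
    have := ((hG.norm.pow 2).sub_const (‖bsC ν‖ ^ 2)).const_mul 2
    simpa using this
  have h2 : Tendsto (fun z => bsG ν z ^ 2 - bsC ν ^ 2) atTop (nhds 0) := by
    have := ((hG.pow 2).sub_const (bsC ν ^ 2))
    simpa using this
  have h3 : Tendsto (fun z : ℝ => (Complex.exp (Complex.I * (2 * z)) *
      (bsG ν z ^ 2 - bsC ν ^ 2)).re) atTop (nhds 0) := by
    refine squeeze_zero_norm (fun z => ?_) (tendsto_zero_iff_norm_tendsto_zero.1 h2)
    refine (Complex.abs_re_le_norm _).trans ?_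
    rw [norm_mul, show Complex.I * (2 * z) = ((2 * z : ℝ) : ℂ) * Complex.I by
        push_cast; ring, Complex.norm_exp_ofReal_mul_I, one_mul]
  have h4 := h1.sub (h3.const_mul 2)
  rw [mul_zero, sub_zero] at h4
  refine h4.congr' ?_
  filter_upwards [eventually_ge_atTop 1] with z hz
  rw [bs_H_eq hν hz, mul_sub (Complex.exp _), Complex.sub_re]
  ring

lemma bs_norm_qmp (d : ℕ) (hd : 1 ≤ d) :
    Measure.QuasiMeasurePreserving (fun x : EuclideanSpace ℝ (Fin d) => ‖x‖) volume volume := by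
  refine ⟨measurable_norm, ?_⟩
  refine Measure.AbsolutelyContinuous.mk fun s hs h0 => ?_
  have : Nontrivial (EuclideanSpace ℝ (Fin d)) := by
    have : Nonempty (Fin d) := ⟨⟨0, hd⟩⟩
    infer_instance
  rw [Measure.map_apply measurable_norm hs]
  have hfin : ∀ n : ℕ, volume ((fun x : EuclideanSpace ℝ (Fin d) => ‖x‖) ⁻¹' (s ∩ Set.Iio n)) = 0 := by
    intro n
    have hsn : MeasurableSet (s ∩ Set.Iio (n:ℝ)) := hs.inter measurableSet_Iio
    have h := integral_fun_norm_addHaar (volume : Measure (EuclideanSpace ℝ (Fin d)))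
      ((s ∩ Set.Iio (n:ℝ)).indicator (fun _ => (1:ℝ)))
    have h0' : volume (s ∩ Set.Iio (n:ℝ)) = 0 := measure_mono_null Set.inter_subset_left h0
    have hz : ∫ y in Set.Ioi (0:ℝ), y ^ (Module.finrank ℝ (EuclideanSpace ℝ (Fin d)) - 1) •
        (s ∩ Set.Iio (n:ℝ)).indicator (fun _ => (1:ℝ)) y = 0 := by
      apply integral_eq_zero_of_ae
      have : ∀ᵐ y : ℝ, y ∉ s ∩ Set.Iio (n:ℝ) := measure_eq_zero_iff_ae_notMem.1 h0'
      filter_upwards [ae_restrict_of_ae this] with y hy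
      simp [Set.indicator_of_notMem hy]
    rw [hz, smul_zero, smul_zero] at h
    have h' : ∫ x : EuclideanSpace ℝ (Fin d), ((fun x : EuclideanSpace ℝ (Fin d) => ‖x‖) ⁻¹'
        (s ∩ Set.Iio (n:ℝ))).indicator (fun _ => (1:ℝ)) x = 0 := by
      rw [← h]; rfl
    rw [integral_indicator_const _ (measurable_norm hsn), smul_eq_mul, mul_one] at h'
    refine (measureReal_eq_zero_iff ?_).1 h'
    refine ((measure_mono (t := Metric.ball 0 n) ?_).trans_lt measure_ball_lt_top).ne
    intro x hx
    simpa using hx.2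
  have : ((fun x : EuclideanSpace ℝ (Fin d) => ‖x‖) ⁻¹' s) =
      ⋃ n : ℕ, ((fun x : EuclideanSpace ℝ (Fin d) => ‖x‖) ⁻¹' (s ∩ Set.Iio n)) := by
    rw [← Set.preimage_iUnion, ← Set.inter_iUnion, Set.preimage_inter]
    ext x
    simp [exists_nat_gt]
  rw [this]
  exact measure_iUnion_null hfin

lemma bs_dist_qmp (d : ℕ) (hd : 1 ≤ d) :
    Measure.QuasiMeasurePreserving (fun p : EuclideanSpace ℝ (Fin d) × EuclideanSpace ℝ (Fin d) =>
      ‖p.1 - p.2‖) volume volume := by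
  have h1 := (measurePreserving_sub_prod (volume : Measure (EuclideanSpace ℝ (Fin d)))
    (volume : Measure (EuclideanSpace ℝ (Fin d)))).quasiMeasurePreserving
  have h2 : Measure.QuasiMeasurePreserving (Prod.fst : EuclideanSpace ℝ (Fin d) ×
    EuclideanSpace ℝ (Fin d) → _) (volume.prod volume) volume := Measure.quasiMeasurePreserving_fst
  exact (bs_norm_qmp d hd).comp (h2.comp h1)

lemma bs_RL {X : Type*} [MeasurableSpace X] {μ : Measure X} {g : X → ℝ} (hg : Integrable g μ)
    (hg0 : ∀ x, 0 ≤ g x) {r : X → ℝ} (hr : Measure.QuasiMeasurePreserving r μ volume) :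
    Tendsto (fun L : ℝ => ∫ x, Complex.exp (Complex.I * (2 * (L * π * r x : ℝ))) * g x ∂μ)
      atTop (nhds 0) := by
  set m := (μ.withDensity (fun x => ENNReal.ofReal (g x))).map r with hm
  have hfin : IsFiniteMeasure (μ.withDensity (fun x => ENNReal.ofReal (g x))) :=
    isFiniteMeasure_withDensity_ofReal hg.2
  have hmfin : IsFiniteMeasure m := by rw [hm]; infer_instance
  have hac : m ≪ volume :=
    ((withDensity_absolutelyContinuous _ _).map hr.measurable).trans hr.absolutelyContinuous
  have h := (Real.tendsto_integral_exp_smul_cocompact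
    (fun s : ℝ => (((m.rnDeriv volume s).toReal : ℝ) : ℂ))).mono_left
      (show atBot ≤ cocompact ℝ from atBot_le_cocompact)
  have h2 := h.comp tendsto_neg_atTop_atBot
  refine h2.congr fun L => ?_
  simp only [Function.comp]
  have e1 : ∫ v : ℝ, (Real.fourierChar (-(v * -L))) • (((m.rnDeriv volume v).toReal : ℝ) : ℂ) =
      ∫ v, Complex.exp (Complex.I * (2 * (L * π * v : ℝ))) ∂m := by
    rw [← integral_rnDeriv_smul hac]
    congr 1; ext v
    rw [Circle.smul_def, Real.fourierChar_apply, smul_eq_mul, Complex.real_smul, mul_comm]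
    congr 2; push_cast; ring
  rw [e1, hm, integral_map hr.measurable.aemeasurable (by fun_prop),
    integral_withDensity_eq_integral_toReal_smul₀ hg.1.aemeasurable.ennreal_ofReal
      (by simp)]
  congr 1; ext x
  rw [ENNReal.toReal_ofReal (hg0 x), Complex.real_smul, mul_comm]

lemma bs_abstract {X : Type*} [MeasurableSpace X] {μ : Measure X} {g : X → ℝ} (hg : Integrable g μ)
    (hg0 : ∀ x, 0 ≤ g x) {r : X → ℝ} (hr : Measure.QuasiMeasurePreserving r μ volume)
    (hr0 : ∀ x, 0 ≤ r x) {H : ℝ → ℝ} (hH : Measurable H) {M : ℝ} (hM : ∀ z, 0 ≤ z → |H z| ≤ M)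
    {A : ℝ} {B : ℂ}
    (hlim : Tendsto (fun z => H z - (A - 2 * (Complex.exp (Complex.I * (2 * z)) * B).re)) atTop
      (nhds 0)) :
    Tendsto (fun L : ℝ => ∫ x, g x * H (L * π * r x) ∂μ) atTop (nhds (A * ∫ x, g x ∂μ)) := by
  have hrm := hr.measurable
  have hgm := hg.1
  have hne : ∀ᵐ x ∂μ, r x ≠ 0 := by
    have : ∀ᵐ s : ℝ, s ≠ 0 := by simp [ae_iff]
    exact hr.ae this
  have hexp : ∀ z : ℝ, |(Complex.exp (Complex.I * (2 * z)) * B).re| ≤ ‖B‖ := by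
    intro z
    refine (Complex.abs_re_le_norm _).trans ?_
    rw [norm_mul, show Complex.I * (2 * z) = ((2 * z : ℝ) : ℂ) * Complex.I by
        push_cast; ring, Complex.norm_exp_ofReal_mul_I, one_mul]
  have hEm : Measurable fun z : ℝ => (Complex.exp (Complex.I * (2 * z)) * B).re := by fun_prop
  -- error term
  have t1 : Tendsto (fun L : ℝ => ∫ x, g x * (H (L * π * r x) -
      (A - 2 * (Complex.exp (Complex.I * (2 * (L * π * r x : ℝ))) * B).re)) ∂μ) atTop (nhds 0) := by
    have : (0:ℝ) = ∫ x, g x * 0 ∂μ := by simp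
    rw [this]
    refine tendsto_integral_filter_of_dominated_convergence
      (fun x => g x * (M + (|A| + 2 * ‖B‖))) ?_ ?_ (hg.mul_const _) ?_
    · refine Eventually.of_forall fun L => hgm.mul (Measurable.aestronglyMeasurable ?_)
      have hl : Measurable fun x => L * π * r x := by fun_prop
      exact (hH.comp hl).sub (measurable_const.sub ((hEm.comp hl).const_mul 2))
    · filter_upwards [eventually_ge_atTop 0] with L hL
      refine Eventually.of_forall fun x => ?_
      rw [norm_mul, Real.norm_of_nonneg (hg0 x)]
      refine mul_le_mul_of_nonneg_left ?_ (hg0 x)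
      have hz : 0 ≤ L * π * r x := mul_nonneg (mul_nonneg hL pi_pos.le) (hr0 x)
      refine (norm_sub_le _ _).trans (add_le_add (hM _ hz) ?_)
      refine (norm_sub_le _ _).trans (add_le_add le_rfl ?_)
      rw [norm_mul, Real.norm_eq_abs, Real.norm_eq_abs, abs_two]
      have := hexp (L * π * r x)
      linarith
    · filter_upwards [hne] with x hx
      apply Tendsto.const_mul
      have hpos : 0 < r x := lt_of_le_of_ne (hr0 x) (Ne.symm hx)
      have : Tendsto (fun L : ℝ => L * π * r x) atTop atTop :=
        (tendsto_id.atTop_mul_const pi_pos).atTop_mul_const hpos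
      exact hlim.comp this
  have t2 := bs_RL hg hg0 hr
  have t3 : Tendsto (fun L : ℝ => A * ∫ x, g x ∂μ -
      2 * (B * ∫ x, Complex.exp (Complex.I * (2 * (L * π * r x : ℝ))) * g x ∂μ).re) atTop
      (nhds (A * ∫ x, g x ∂μ)) := by
    have := ((Complex.continuous_re.tendsto _).comp (t2.const_mul B)).const_mul 2
    have := this.const_sub (A * ∫ x, g x ∂μ)
    simpa using this
  have t4 := t1.add t3
  rw [zero_add] at t4
  refine t4.congr' ?_
  filter_upwards [eventually_ge_atTop 0] with L hL
  have hl : Measurable fun x => L * π * r x := by fun_prop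
  have hz : ∀ x, 0 ≤ L * π * r x := fun x => mul_nonneg (mul_nonneg hL pi_pos.le) (hr0 x)
  have i1 : Integrable (fun x => g x * H (L * π * r x)) μ :=
    hg.mul_bdd (c := M) (hH.comp hl).aestronglyMeasurable (Eventually.of_forall fun x => hM _ (hz x))
  have i2 : Integrable (fun x => g x *
      (Complex.exp (Complex.I * (2 * (L * π * r x : ℝ))) * B).re) μ :=
    hg.mul_bdd (c := ‖B‖) (hEm.comp hl).aestronglyMeasurable (Eventually.of_forall fun x => hexp _)
  have i3 : Integrable (fun x => Complex.exp (Complex.I * (2 * (L * π * r x : ℝ))) * (g x : ℂ)) μ := by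
    refine hg.ofReal.bdd_mul (c := 1) (by fun_prop) (Eventually.of_forall fun x => ?_)
    rw [show Complex.I * (2 * (L * π * r x : ℝ)) = ((2 * (L * π * r x) : ℝ) : ℂ) * Complex.I by
        push_cast; ring, Complex.norm_exp_ofReal_mul_I]
  have e3 : (B * ∫ x, Complex.exp (Complex.I * (2 * (L * π * r x : ℝ))) * g x ∂μ).re =
      ∫ x, g x * (Complex.exp (Complex.I * (2 * (L * π * r x : ℝ))) * B).re ∂μ := by
    rw [← integral_const_mul]
    have := integral_re (i3.const_mul B)
    simp only [RCLike.re_eq_complex_re] at this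
    rw [← this]
    congr 1; ext x
    rw [show B * (Complex.exp (Complex.I * (2 * (L * π * r x : ℝ))) * (g x : ℂ)) =
      (g x : ℂ) * (Complex.exp (Complex.I * (2 * (L * π * r x : ℝ))) * B) by ring,
      Complex.re_ofReal_mul]
  rw [e3, ← integral_const_mul, ← integral_const_mul, ← integral_sub (hg.const_mul A) (i2.const_mul 2),
    ← integral_add]
  · congr 1; ext x; ring
  · have := i1.sub ((hg.const_mul A).sub (i2.const_mul 2))
    refine this.congr (Eventually.of_forall fun x => ?_)
    simp only [Pi.sub_apply]; ring
  · exact (hg.const_mul A).sub (i2.const_mul 2)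
lemma bs_pointwise (d : ℕ) (f : EuclideanSpace ℝ (Fin d) → ℝ) {L : ℝ} (hL : 0 < L)
    (x y : EuclideanSpace ℝ (Fin d)) :
    (1 / L ^ ((d : ℝ) - 1)) * (1 / 2) * (|f x - f y| ^ 2 * besselKernel d L x y ^ 2) =
      (Real.Gamma ((d : ℝ) / 2 + 1) ^ 2 / (2 * π ^ ((d : ℝ) + 2) *
        Real.Gamma (((d : ℝ) - 1) / 2 + 1) ^ 2)) *
      ((|f x - f y| ^ 2 / ‖x - y‖ ^ ((d : ℝ) + 1)) * bsH (((d : ℝ) - 1) / 2) (L * π * ‖x - y‖)) := by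
  rcases eq_or_ne x y with rfl | hxy
  · simp
  have hr : 0 < ‖x - y‖ := norm_pos_iff.2 (sub_ne_zero.2 hxy)
  set r := ‖x - y‖
  set D := |f x - f y| ^ 2
  have hG : 0 < Real.Gamma (((d : ℝ) - 1) / 2 + 1) := by
    apply Real.Gamma_pos_of_pos; have : (0:ℝ) ≤ d := Nat.cast_nonneg d; linarith
  unfold besselKernel besselJ bsH bsI
  rw [show (d:ℝ) / 2 + 1 / 2 = ((d:ℝ) - 1) / 2 + 1 by ring,
    show (d:ℝ) / 2 - 1 / 2 = ((d:ℝ) - 1) / 2 by ring]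
  set J := ∫ t in (-1 : ℝ)..1, Real.cos (L * π * r * t) * (1 - t ^ 2) ^ (((d:ℝ) - 1) / 2)
  set G1 := Real.Gamma ((d : ℝ) / 2 + 1)
  set G2 := Real.Gamma (((d : ℝ) - 1) / 2 + 1)
  have hp := pi_pos
  have sq : ∀ {a : ℝ}, 0 < a → (a ^ ((d:ℝ) / 2)) ^ 2 = a ^ d := by
    intro a ha
    rw [← Real.rpow_natCast, ← Real.rpow_mul ha.le, ← Real.rpow_natCast]
    congr 1; push_cast; ring
  have sq2 : ∀ {a : ℝ}, 0 < a → (a ^ (((d:ℝ) - 1) / 2 + 1)) ^ 2 = a ^ d * a := by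
    intro a ha
    rw [← Real.rpow_natCast, ← Real.rpow_mul ha.le, ← Real.rpow_natCast, ← Real.rpow_add_one ha.ne']
    congr 1; push_cast; ring
  have hs : √π ^ 2 = π := Real.sq_sqrt hp.le
  simp only [mul_pow, div_pow]
  rw [sq two_pos, sq hL, sq (by positivity : 0 < L * π * r / 2), sq (by positivity : 0 < π * r),
    sq2 (by positivity : 0 < L * π * r), hs, Real.rpow_sub hL, Real.rpow_add hr, Real.rpow_add hp]
  simp only [Real.rpow_natCast, Real.rpow_one, Real.rpow_two, mul_pow, div_pow]
  field_simp

/-- Smooth linear statistics of the Bessel point process: for `f ∈ H^{1/2}(ℝ^d)`,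
`L^{−(d−1)}(1/2)∬ |f(x)−f(y)|² K_L(x,y)² dx dy →
  (2^{d−1}Γ(d/2+1)²/π^{d+2}) ∬ |f(x)−f(y)|²/|x−y|^{d+1} dx dy`. -/
theorem bessel_smooth_statistics
    (d : ℕ) (hd : 1 ≤ d) (f : EuclideanSpace ℝ (Fin d) → ℝ) (hmeas : Measurable f)
    (hgag : Integrable
      (fun p : EuclideanSpace ℝ (Fin d) × EuclideanSpace ℝ (Fin d) =>
        |f p.1 - f p.2| ^ 2 / ‖p.1 - p.2‖ ^ ((d : ℝ) + 1))) :
    Tendsto (fun L : ℝ =>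
        (1 / L ^ ((d : ℝ) - 1)) * (1 / 2) *
          ∫ x, ∫ y, |f x - f y| ^ 2 * besselKernel d L x y ^ 2)
      atTop
      (nhds ((2 ^ ((d : ℝ) - 1) * Real.Gamma ((d : ℝ) / 2 + 1) ^ 2 / π ^ ((d : ℝ) + 2)) *
        ∫ x, ∫ y, |f x - f y| ^ 2 / ‖x - y‖ ^ ((d : ℝ) + 1))) := by
  have hν : (0:ℝ) ≤ ((d:ℝ) - 1) / 2 := by
    have : (1:ℝ) ≤ d := by exact_mod_cast hd
    linarith
  have hqmp := bs_dist_qmp d hd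
  have hHc : Continuous (bsH (((d:ℝ) - 1) / 2)) := by
    unfold bsH
    exact ((Real.continuous_rpow_const (by linarith)).mul (bs_I_cont hν)).pow 2
  obtain ⟨M, hM⟩ := bs_H_bound hν
  have main := bs_abstract hgag (fun p => by positivity) hqmp (fun p => norm_nonneg _)
    hHc.measurable hM (bs_H_tendsto hν)
  have hG : 0 < Real.Gamma (((d : ℝ) - 1) / 2 + 1) := Real.Gamma_pos_of_pos (by linarith)
  have main2 := main.const_mul (Real.Gamma ((d : ℝ) / 2 + 1) ^ 2 / (2 * π ^ ((d : ℝ) + 2) *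
        Real.Gamma (((d : ℝ) - 1) / 2 + 1) ^ 2))
  have hlimeq : (2 ^ ((d : ℝ) - 1) * Real.Gamma ((d : ℝ) / 2 + 1) ^ 2 / π ^ ((d : ℝ) + 2)) *
        ∫ x, ∫ y, |f x - f y| ^ 2 / ‖x - y‖ ^ ((d : ℝ) + 1) =
      (Real.Gamma ((d : ℝ) / 2 + 1) ^ 2 / (2 * π ^ ((d : ℝ) + 2) *
        Real.Gamma (((d : ℝ) - 1) / 2 + 1) ^ 2)) * (2 * ‖bsC (((d:ℝ) - 1) / 2)‖ ^ 2 *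
        ∫ p : EuclideanSpace ℝ (Fin d) × EuclideanSpace ℝ (Fin d),
          |f p.1 - f p.2| ^ 2 / ‖p.1 - p.2‖ ^ ((d : ℝ) + 1)) := by
    rw [← integral_prod _ hgag]
    change _ * (∫ p : EuclideanSpace ℝ (Fin d) × EuclideanSpace ℝ (Fin d),
          |f p.1 - f p.2| ^ 2 / ‖p.1 - p.2‖ ^ ((d : ℝ) + 1)) = _
    have h2 : ((2:ℝ) ^ (((d:ℝ) - 1) / 2)) ^ 2 = 2 ^ ((d:ℝ) - 1) := by
      rw [← Real.rpow_natCast, ← Real.rpow_mul two_pos.le]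
      congr 1; push_cast; ring
    rw [bs_C_norm hν, mul_pow, h2]
    have hp := pi_pos
    generalize Real.Gamma (((d : ℝ) - 1) / 2 + 1) = G2 at hG ⊢
    field_simp
  rw [hlimeq]
  refine main2.congr' ?_
  filter_upwards [eventually_gt_atTop 0] with L hL
  have hl : Measurable fun p : EuclideanSpace ℝ (Fin d) × EuclideanSpace ℝ (Fin d) =>
      L * π * ‖p.1 - p.2‖ := by fun_prop
  have hint : Integrable (fun p : EuclideanSpace ℝ (Fin d) × EuclideanSpace ℝ (Fin d) =>
      (|f p.1 - f p.2| ^ 2 / ‖p.1 - p.2‖ ^ ((d : ℝ) + 1)) *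
        bsH (((d : ℝ) - 1) / 2) (L * π * ‖p.1 - p.2‖)) :=
    hgag.mul_bdd (c := M) (hHc.measurable.comp hl).aestronglyMeasurable
      (Eventually.of_forall fun p => hM _ (by positivity))
  have hfub := integral_prod _ hint
  rw [← integral_const_mul]
  simp_rw [← integral_const_mul, bs_pointwise d f hL]
  simp_rw [integral_const_mul]
  congr 1

end
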